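/- Let f be a formal power series (or real-analytic function near 0) with f(0) = 1 satisfying f'(z) = -f(-z)². Define h(z) := f(z) + f'(z) and σ(z) := 1 - f(z)·f(-z). Then for all x, y, the addition formula holds: f(x+y)·(1 - (1/3)σ(x)σ(y)) = f(x)f(y) - (1/3)h(x)h(y). -/

import Mathlib

/-- Two functions on a preconnected open set that satisfy `u'w = uw'` together with the relations
obtained by differentiating it, and that have no common zero of order at least two, keep the
ratio they have at any base point. -/
theorem eq_const_mul_of_wronskian_eq_zero {I : Set ℝ} (hI : IsOpen I) (hI' : IsPreconnected I)
    {u u' u'' w w' w'' : ℝ → ℝ}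
    (hu : ∀ t ∈ I, HasDerivAt u (u' t) t) (hu' : ∀ t ∈ I, HasDerivAt u' (u'' t) t)
    (hw : ∀ t ∈ I, HasDerivAt w (w' t) t) (hw' : ∀ t ∈ I, HasDerivAt w' (w'' t) t)
    (h01 : ∀ t ∈ I, u t * w' t = u' t * w t) (h02 : ∀ t ∈ I, u t * w'' t = u'' t * w t)
    (h12 : ∀ t ∈ I, u' t * w'' t = u'' t * w' t)
    (hne : ∀ t ∈ I, ¬ (u t = 0 ∧ w t = 0 ∧ u' t = 0 ∧ w' t = 0))
    {t₀ t : ℝ} (ht₀ : t₀ ∈ I) (ht : t ∈ I) {k : ℝ}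
    (hk : u t₀ = k * w t₀) (hw₀ : w t₀ ≠ 0) : u t = k * w t := by
  set T : ℝ → ℝ := fun t => u t ^ 2 + w t ^ 2 + u' t ^ 2 + w' t ^ 2 with hT
  set S : ℝ → ℝ := fun t => (u t - k * w t) ^ 2 + (u' t - k * w' t) ^ 2 with hS
  have hTne : ∀ t ∈ I, T t ≠ 0 := by
    intro t ht h
    simp only [hT] at h
    apply hne t ht
    refine ⟨?_, ?_, ?_, ?_⟩ <;> apply pow_eq_zero_iff two_ne_zero |>.mp <;>
      nlinarith [sq_nonneg (u t), sq_nonneg (w t), sq_nonneg (u' t), sq_nonneg (w' t)]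
  have hderiv : ∀ t ∈ I, HasDerivAt (fun t => S t / T t) 0 t := by
    intro t ht
    have hTd := ((((hu t ht).pow 2).add ((hw t ht).pow 2)).add ((hu' t ht).pow 2)).add
      ((hw' t ht).pow 2)
    have hSd := (((hu t ht).sub ((hw t ht).const_mul k)).pow 2).add
      (((hu' t ht).sub ((hw' t ht).const_mul k)).pow 2)
    refine (hSd.fun_div hTd (hTne t ht)).congr_deriv ?_
    have e1 := h01 t ht
    have e2 := h02 t ht
    have e3 := h12 t ht
    rw [div_eq_zero_iff]
    left
    simp only [Pi.add_apply, Pi.pow_apply, Pi.sub_apply]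
    push_cast
    grind
  have hconst : S t / T t = S t₀ / T t₀ :=
    hI.is_const_of_deriv_eq_zero hI'
      (fun t ht => (hderiv t ht).differentiableAt.differentiableWithinAt)
      (fun t ht => (hderiv t ht).deriv) ht ht₀
  have hS₀ : S t₀ = 0 := by
    have h' : u' t₀ = k * w' t₀ := by
      apply mul_right_cancel₀ hw₀
      rw [← h01 t₀ ht₀, hk]
      ring
    simp [hS, hk, h']
  rw [hS₀, zero_div, div_eq_zero_iff, or_iff_left (hTne t ht)] at hconst
  have : (u t - k * w t) ^ 2 = 0 := by
    simp only [hS] at hconst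
    nlinarith [sq_nonneg (u t - k * w t), sq_nonneg (u' t - k * w' t)]
  exact sub_eq_zero.mp (pow_eq_zero_iff two_ne_zero |>.mp this)

/-- The first integral `f(z)³ + f(-z)³ = 2` of the equation `f'(z) = -f(-z)²`. -/
theorem cube_add_cube_neg_eq_two {f : ℝ → ℝ} {ε : ℝ} (h0 : f 0 = 1)
    (hf : ∀ z ∈ Set.Ioo (-ε) ε, HasDerivAt f (-(f (-z)) ^ 2) z)
    (hfneg : ∀ z ∈ Set.Ioo (-ε) ε, HasDerivAt (fun t => f (-t)) (f z ^ 2) z)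
    {z : ℝ} (hz : z ∈ Set.Ioo (-ε) ε) : f z ^ 3 + f (-z) ^ 3 = 2 := by
  have hderiv : ∀ t ∈ Set.Ioo (-ε) ε, HasDerivAt (fun t => f t ^ 3 + f (-t) ^ 3) 0 t := by
    intro t ht
    refine (((hf t ht).fun_pow 3).fun_add ((hfneg t ht).fun_pow 3)).congr_deriv ?_
    push_cast
    ring
  have hε : (0 : ℝ) ∈ Set.Ioo (-ε) ε := by
    constructor <;> linarith [hz.1, hz.2]
  have h := isOpen_Ioo.is_const_of_deriv_eq_zero isPreconnected_Ioo
    (fun t ht => (hderiv t ht).differentiableAt.differentiableWithinAt)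
    (fun t ht => (hderiv t ht).deriv) hz hε
  simp only [neg_zero, h0] at h
  rw [h]
  norm_num

theorem stmt_14 (f : ℝ → ℝ) (ε : ℝ) (hε : 0 < ε) (h0 : f 0 = 1)
    (hf : ∀ z ∈ Set.Ioo (-ε) ε, HasDerivAt f (-(f (-z)) ^ 2) z)
    (h σ : ℝ → ℝ)
    (hh : ∀ z, h z = f z + deriv f z)
    (hσ : ∀ z, σ z = 1 - f z * f (-z)) :
    ∀ x ∈ Set.Ioo (-ε) ε, ∀ y ∈ Set.Ioo (-ε) ε, x + y ∈ Set.Ioo (-ε) ε →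
      f (x + y) * (1 - (1/3) * (σ x * σ y)) = f x * f y - (1/3) * (h x * h y) := by
  intro x hx y hy hxy
  have neg_mem : ∀ z ∈ Set.Ioo (-ε) ε, -z ∈ Set.Ioo (-ε) ε := fun z hz =>
    ⟨by linarith [hz.2], by linarith [hz.1]⟩
  have hfneg : ∀ z ∈ Set.Ioo (-ε) ε, HasDerivAt (fun t => f (-t)) (f z ^ 2) z := by
    intro z hz
    refine ((hf (-z) (neg_mem z hz)).scomp z (hasDerivAt_neg z)).congr_deriv ?_
    simp
  have hcube := fun z hz => cube_add_cube_neg_eq_two h0 hf hfneg (z := z) hz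
  rw [hh, hh, (hf x hx).deriv, (hf y hy).deriv, hσ, hσ]
  obtain ⟨s, rfl⟩ : ∃ s, y = s - x := ⟨x + y, by ring⟩
  rw [add_sub_cancel] at hxy ⊢
  set I : Set ℝ := Set.Ioo (-ε) ε ∩ Set.Ioo (s - ε) (s + ε) with hI
  have sub_mem : ∀ t ∈ I, s - t ∈ Set.Ioo (-ε) ε := fun t ht =>
    ⟨by linarith [ht.2.2], by linarith [ht.2.1]⟩
  have ha : ∀ t ∈ I, HasDerivAt f (-(f (-t)) ^ 2) t := fun t ht => hf t ht.1
  have hb : ∀ t ∈ I, HasDerivAt (fun t => f (-t)) (f t ^ 2) t := fun t ht => hfneg t ht.1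
  have hc : ∀ t ∈ I, HasDerivAt (fun t => f (s - t)) (f (-(s - t)) ^ 2) t := by
    intro t ht
    refine ((hf _ (sub_mem t ht)).scomp t ((hasDerivAt_id t).const_sub s)).congr_deriv ?_
    simp
  have hd : ∀ t ∈ I, HasDerivAt (fun t => f (-(s - t))) (-f (s - t) ^ 2) t := by
    intro t ht
    refine ((hfneg _ (sub_mem t ht)).scomp t ((hasDerivAt_id t).const_sub s)).congr_deriv ?_
    simp
  obtain ⟨a, rfl⟩ : ∃ a, a = f := ⟨f, rfl⟩
  set b : ℝ → ℝ := fun t => a (-t) with hbdef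
  set c : ℝ → ℝ := fun t => a (s - t) with hcdef
  set d : ℝ → ℝ := fun t => a (-(s - t)) with hddef
  have hcubes : ∀ t ∈ I, a t ^ 3 + b t ^ 3 = 2 ∧ c t ^ 3 + d t ^ 3 = 2 :=
    fun t ht => ⟨hcube _ ht.1, hcube _ (sub_mem t ht)⟩
  have key := eq_const_mul_of_wronskian_eq_zero (I := I) (t₀ := 0) (t := x) (k := a s)
    (u := fun t => 3 * (a t * c t) - (a t - b t ^ 2) * (c t - d t ^ 2))
    (u' := fun t => 3 * (a t * d t ^ 2 - b t ^ 2 * c t)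
      + (b t ^ 2 + 2 * (a t ^ 2 * b t)) * (c t - d t ^ 2)
      - (a t - b t ^ 2) * (d t ^ 2 + 2 * (c t ^ 2 * d t)))
    (u'' := fun t => -6 * (b t ^ 2 * d t ^ 2 + a t * d t * c t ^ 2 + b t * a t ^ 2 * c t)
      + (2 * a t ^ 2 * b t - 4 * a t * b t ^ 3 + 2 * a t ^ 4) * (c t - d t ^ 2)
      + 2 * (b t ^ 2 + 2 * a t ^ 2 * b t) * (d t ^ 2 + 2 * c t ^ 2 * d t)
      - (a t - b t ^ 2) * (4 * c t * d t ^ 3 - 2 * c t ^ 2 * d t - 2 * c t ^ 4))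
    (w := fun t => 3 - (1 - a t * b t) * (1 - c t * d t))
    (w' := fun t => (a t ^ 3 - b t ^ 3) * (1 - c t * d t) + (1 - a t * b t) * (d t ^ 3 - c t ^ 3))
    (w'' := fun t => -6 * a t ^ 2 * b t ^ 2 * (1 - c t * d t)
      - 2 * (a t ^ 3 - b t ^ 3) * (d t ^ 3 - c t ^ 3) - 6 * c t ^ 2 * d t ^ 2 * (1 - a t * b t))
    (isOpen_Ioo.inter isOpen_Ioo)
    (((convex_Ioo _ _).inter (convex_Ioo _ _)).isPreconnected)
    ?_ ?_ ?_ ?_ ?_ ?_ ?_ ?_ ?_ ?_ ?_ ?_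
  · simp only [hbdef, hcdef, hddef] at key
    linear_combination -(1 / 3) * key
  · intro t ht
    refine ((((ha t ht).fun_mul (hc t ht)).const_mul 3).fun_sub
      (((ha t ht).fun_sub ((hb t ht).fun_pow 2)).fun_mul
        ((hc t ht).fun_sub ((hd t ht).fun_pow 2)))).congr_deriv ?_
    simp only [hbdef, hcdef, hddef]
    push_cast
    ring
  · intro t ht
    refine (((((ha t ht).fun_mul ((hd t ht).fun_pow 2)).fun_sub
      (((hb t ht).fun_pow 2).fun_mul (hc t ht))).const_mul 3).fun_add
      ((((hb t ht).fun_pow 2).fun_add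
        ((((ha t ht).fun_pow 2).fun_mul (hb t ht)).const_mul 2)).fun_mul
        ((hc t ht).fun_sub ((hd t ht).fun_pow 2)))).fun_sub
      (((ha t ht).fun_sub ((hb t ht).fun_pow 2)).fun_mul
        (((hd t ht).fun_pow 2).fun_add ((((hc t ht).fun_pow 2).fun_mul (hd t ht)).const_mul 2)))
      |>.congr_deriv ?_
    simp only [hbdef, hcdef, hddef]
    push_cast
    ring
  · intro t ht
    refine ((((ha t ht).fun_mul (hb t ht)).const_sub 1).fun_mul
      (((hc t ht).fun_mul (hd t ht)).const_sub 1)).const_sub 3 |>.congr_deriv ?_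
    simp only [hbdef, hcdef, hddef]
    ring
  · intro t ht
    refine ((((ha t ht).fun_pow 3).fun_sub ((hb t ht).fun_pow 3)).fun_mul
      (((hc t ht).fun_mul (hd t ht)).const_sub 1)).fun_add
      ((((ha t ht).fun_mul (hb t ht)).const_sub 1).fun_mul
        (((hd t ht).fun_pow 3).fun_sub ((hc t ht).fun_pow 3))) |>.congr_deriv ?_
    simp only [hbdef, hcdef, hddef]
    push_cast
    ring
  · intro t ht
    obtain ⟨h1, h2⟩ := hcubes t ht
    clear_value b c d
    grind
  · intro t ht
    obtain ⟨h1, h2⟩ := hcubes t ht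
    clear_value b c d
    grind
  · intro t ht
    obtain ⟨h1, h2⟩ := hcubes t ht
    clear_value b c d
    grind
  · rintro t ht ⟨e1, e2, e3, e4⟩
    obtain ⟨h1, h2⟩ := hcubes t ht
    clear_value b c d
    grind
  · exact ⟨⟨by linarith, hε⟩, by linarith [hxy.2], by linarith [hxy.1]⟩
  · exact ⟨hx, by linarith [hy.2], by linarith [hy.1]⟩
  · simp [hbdef, hcdef, hddef, h0, mul_comm]
  · simp [hbdef, h0]
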